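/- arXiv:2209.08383 — 6 statements merged into one kernel-verified Lean document; each statement's English description precedes it below -/
import Mathlib

section
/- Forward-Equivalent Reachability Preservation: Let N be an NFA with vertex type V and let ∼ be an equivalence relation on V that refines forward-equivalence (i.e. v ∼ w implies v ∼fwd w). Then for every sequence τ : List (Option A) and every vertex c of the grouped NFA N/∼ that is reachable on τ in N/∼, every v : V with ⟦v⟧ = c is reachable on τ in N. -/
/-- An NFA with accepting actions: vertices `V`, alphabet `A` (edge labels in
`Option A`, with `none` the ε-label), accepting actions `T` with a conflict
relation, starting vertex, edge relation, and accepting-action assignment. -/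
structure NFAA (V A T : Type*) where
  start : V
  edge : V → Option A → V → Prop
  conf : T → T → Prop
  act : V → Set T

variable {V A T : Type*}

/-- `w` is reachable from `v` on the sequence `τ`. -/
def NFAA.ReachFrom (N : NFAA V A T) : V → List (Option A) → V → Prop
  | v, [], w => v = w
  | v, σ :: τ, w => ∃ u : V, N.edge v σ u ∧ N.ReachFrom u τ w

/-- `w` is reachable (from the starting vertex) on the sequence `τ`. -/
def NFAA.Reach (N : NFAA V A T) (τ : List (Option A)) (w : V) : Prop :=
  N.ReachFrom N.start τ w

/-- A conflict: two sequences with equal strings, reaching vertices carrying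
conflicting actions. -/
def NFAA.HasConflict (N : NFAA V A T) : Prop :=
  ∃ τ τ' : List (Option A), ∃ w w' : V, ∃ a a' : T,
    τ.filterMap id = τ'.filterMap id ∧
    N.Reach τ w ∧ N.Reach τ' w' ∧
    a ∈ N.act w ∧ a' ∈ N.act w' ∧ N.conf a a'

/-- The grouped NFA `N/∼` for an equivalence relation (setoid) `s` on `V`. -/
def NFAA.group (N : NFAA V A T) (s : Setoid V) : NFAA (Quotient s) A T where
  start := Quotient.mk s N.start
  edge c σ d := ∃ v w : V, Quotient.mk s v = c ∧ Quotient.mk s w = d ∧ N.edge v σ w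
  conf := N.conf
  act c := {a : T | ∃ v : V, Quotient.mk s v = c ∧ a ∈ N.act v}

/-- Forward equivalence: reachable from the start on exactly the same sequences. -/
def NFAA.FwdEquiv (N : NFAA V A T) (v₁ v₂ : V) : Prop :=
  ∀ τ : List (Option A), N.Reach τ v₁ ↔ N.Reach τ v₂

/-- Backward equivalence with respect to an initial partition `L0`. -/
def NFAA.BwdEquiv (N : NFAA V A T) (L0 : Set (Set V)) (v₁ v₂ : V) : Prop :=
  ∀ Z ∈ L0, ∀ τ : List (Option A),
    (∃ w ∈ Z, N.ReachFrom v₁ τ w) ↔ (∃ w ∈ Z, N.ReachFrom v₂ τ w)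

/-- A partition of `V`: pairwise disjoint nonempty subsets whose union is `V`. -/
def IsPartitionOf (L : Set (Set V)) : Prop :=
  (∀ Z ∈ L, Z.Nonempty) ∧
  (∀ Z ∈ L, ∀ Z' ∈ L, Z ≠ Z' → Z ∩ Z' = ∅) ∧
  ⋃₀ L = Set.univ

/-- `L` refines `L0`: every member of `L` is contained in some member of `L0`. -/
def RefinesPartition (L L0 : Set (Set V)) : Prop :=
  ∀ Y ∈ L, ∃ Z ∈ L0, Y ⊆ Z

/-- The forward image `Z[σ]`. -/
def NFAA.fwdImg (N : NFAA V A T) (Z : Set V) (σ : Option A) : Set V :=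
  {w : V | ∃ z ∈ Z, N.edge z σ w}

/-- The backward image `Z⁻[σ]`. -/
def NFAA.bwdImg (N : NFAA V A T) (Z : Set V) (σ : Option A) : Set V :=
  {z : V | ∃ w ∈ Z, N.edge z σ w}

/-- `L` is forward-stable. -/
def NFAA.FwdStable (N : NFAA V A T) (L : Set (Set V)) : Prop :=
  ∀ Z ∈ L, ∀ σ : Option A, ∀ Y ∈ L,
    Y ⊆ N.fwdImg Z σ ∨ Y ∩ N.fwdImg Z σ = ∅

/-- `L` is backward-stable. -/
def NFAA.BwdStable (N : NFAA V A T) (L : Set (Set V)) : Prop :=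
  ∀ Z ∈ L, ∀ σ : Option A, ∀ Y ∈ L,
    Y ⊆ N.bwdImg Z σ ∨ Y ∩ N.bwdImg Z σ = ∅

/-- `L0` is backward-admissible. -/
def NFAA.BwdAdmissible (N : NFAA V A T) (L0 : Set (Set V)) : Prop :=
  ∀ Z ∈ L0, ∀ Z' ∈ L0,
    (∃ w₁ ∈ Z, ∃ w₂ ∈ Z', ∃ a ∈ N.act w₁, ∃ a' ∈ N.act w₂, N.conf a a') →
    ∀ v₁ ∈ Z, ∀ v₂ ∈ Z', ∃ a ∈ N.act v₁, ∃ a' ∈ N.act v₂, N.conf a a'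

theorem NFAA.ReachFrom.snoc {N : NFAA V A T} {τ : List (Option A)} {σ : Option A} {u v w : V}
    (h : N.ReachFrom u τ v) (he : N.edge v σ w) : N.ReachFrom u (τ ++ [σ]) w := by
  induction τ generalizing u with
  | nil =>
    cases h
    exact ⟨w, he, rfl⟩
  | cons _ _ ih =>
    obtain ⟨x, hx, h⟩ := h
    exact ⟨x, hx, ih h⟩

/-- If every member of the class `c` is reachable on `ρ` and `d` is reachable from `c` on `τ` in
the grouped NFA, then every member of `d` is reachable on `ρ ++ τ`. -/
theorem NFAA.reach_append_of_group_reachFrom {N : NFAA V A T} {s : Setoid V}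
    (hrefine : ∀ v w : V, s.r v w → N.FwdEquiv v w) {ρ τ : List (Option A)} {c d : Quotient s}
    (hc : ∀ v : V, Quotient.mk s v = c → N.Reach ρ v) (h : (N.group s).ReachFrom c τ d)
    (v : V) (hv : Quotient.mk s v = d) : N.Reach (ρ ++ τ) v := by
  induction τ generalizing ρ c with
  | nil =>
    rw [List.append_nil]
    exact hc v (hv.trans (Eq.symm h))
  | cons σ τ ih =>
    obtain ⟨e, ⟨x, y, hx, hy, hxy⟩, h⟩ := h
    rw [List.append_cons]
    refine ih (fun z hz => ?_) h
    exact (hrefine z y (Quotient.exact (hz.trans hy.symm)) _).mpr ((hc x hx).snoc hxy)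

/-- **Forward-Equivalent Reachability Preservation.** If the equivalence
relation `s` refines forward-equivalence, then every vertex of the grouped NFA
reachable on `τ` consists only of vertices reachable on `τ` in `N`. -/
theorem fwd_equiv_reachability_preservation (N : NFAA V A T) (s : Setoid V)
    (hrefine : ∀ v w : V, s.r v w → N.FwdEquiv v w) :
    ∀ (τ : List (Option A)) (c : Quotient s),
      (N.group s).Reach τ c →
        ∀ v : V, Quotient.mk s v = c → N.Reach τ v := by
  intro τ c h
  exact NFAA.reach_append_of_group_reachFrom hrefine (ρ := [])
    (fun v hv => (hrefine v N.start (Quotient.exact hv) []).mpr rfl) h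
end

section
/- Forward-Equivalent Conflict Preservation: Let N be an NFA with vertex type V and let ∼ be an equivalence relation on V that refines forward-equivalence (i.e. v ∼ w implies v ∼fwd w). Then the grouped NFA N/∼ has a conflict if and only if N has a conflict. -/
variable {V A T : Type*}

namespace NFAA

theorem ReachFrom.snoc_s1 {N : NFAA V A T} {v u w : V} {τ : List (Option A)} {σ : Option A}
    (h : N.ReachFrom v τ u) (e : N.edge u σ w) : N.ReachFrom v (τ ++ [σ]) w := by
  induction τ generalizing v with
  | nil => cases h; exact ⟨w, e, rfl⟩
  | cons ρ τ ih =>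
    obtain ⟨x, hx, h⟩ := h
    exact ⟨x, hx, ih h⟩

theorem ReachFrom.group {N : NFAA V A T} (s : Setoid V) {v w : V} {τ : List (Option A)}
    (h : N.ReachFrom v τ w) :
    (N.group s).ReachFrom (Quotient.mk s v) τ (Quotient.mk s w) := by
  induction τ generalizing v with
  | nil => cases h; rfl
  | cons σ τ ih =>
    obtain ⟨u, hu, h⟩ := h
    exact ⟨Quotient.mk s u, ⟨v, u, rfl, rfl, hu⟩, ih h⟩

/-- If every member of the class `c` is reachable on `τ₀`, then a path in the grouped NFA from `c`
labelled `τ` ends in a class whose members are all reachable on `τ₀ ++ τ`. -/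
theorem reach_append_of_group_reachFrom_s1 {N : NFAA V A T} {s : Setoid V}
    (hrefine : ∀ v w : V, s.r v w → N.FwdEquiv v w) {c : Quotient s}
    {τ₀ τ : List (Option A)} {w : V} (hc : ∀ v, Quotient.mk s v = c → N.Reach τ₀ v)
    (h : (N.group s).ReachFrom c τ (Quotient.mk s w)) : N.Reach (τ₀ ++ τ) w := by
  induction τ generalizing c τ₀ with
  | nil => simpa using hc w (Eq.symm h)
  | cons σ τ ih =>
    obtain ⟨d, ⟨x, y, hx, hy, e⟩, h⟩ := h
    have hd : ∀ v, Quotient.mk s v = d → N.Reach (τ₀ ++ [σ]) v := fun v hv =>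
      (hrefine y v (Quotient.exact (hy.trans hv.symm)) _).1 (ReachFrom.snoc_s1 (hc x hx) e)
    simpa using ih hd h

theorem group_reach_iff {N : NFAA V A T} {s : Setoid V}
    (hrefine : ∀ v w : V, s.r v w → N.FwdEquiv v w) {τ : List (Option A)} {w : V} :
    (N.group s).Reach τ (Quotient.mk s w) ↔ N.Reach τ w :=
  ⟨fun h => reach_append_of_group_reachFrom_s1 (τ₀ := []) hrefine
    (fun v hv => (hrefine N.start v (Quotient.exact hv.symm) []).1 rfl) h,
    fun h => ReachFrom.group s h⟩

end NFAA

/-- **Forward-Equivalent Conflict Preservation.** If the equivalence relation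
`s` refines forward-equivalence, then the grouped NFA has a conflict iff the
original NFA has a conflict. -/
theorem fwd_equiv_conflict_preservation (N : NFAA V A T) (s : Setoid V)
    (hrefine : ∀ v w : V, s.r v w → N.FwdEquiv v w) :
    (N.group s).HasConflict ↔ N.HasConflict := by
  constructor
  · rintro ⟨τ, τ', _, _, a, a', hs, hw, hw', ⟨v, rfl, ha⟩, ⟨v', rfl, ha'⟩, hconf⟩
    exact ⟨τ, τ', v, v', a, a', hs, (NFAA.group_reach_iff hrefine).1 hw,
      (NFAA.group_reach_iff hrefine).1 hw', ha, ha', hconf⟩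
  · rintro ⟨τ, τ', w, w', a, a', hs, hw, hw', ha, ha', hconf⟩
    exact ⟨τ, τ', Quotient.mk s w, Quotient.mk s w', a, a', hs,
      (NFAA.group_reach_iff hrefine).2 hw, (NFAA.group_reach_iff hrefine).2 hw',
      ⟨w, rfl, ha⟩, ⟨w', rfl, ha'⟩, hconf⟩
end

section
/- Forward Refinement Correctness (fixed-point form): Let N be an NFA with vertex type V, and let L be a partition of V such that the member of L containing the starting vertex v₀ is the singleton {v₀}, and such that L is forward-stable. Then for every sequence τ : List (Option A), letting R(τ) := {w | w is reachable on τ}, every Z ∈ L satisfies Z ⊆ R(τ) or Z ∩ R(τ) = ∅. -/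
variable {V A T : Type*}

theorem NFAA.reachFrom_append_singleton (N : NFAA V A T) (v : V) (τ : List (Option A))
    (σ : Option A) (w : V) :
    N.ReachFrom v (τ ++ [σ]) w ↔ ∃ z, N.ReachFrom v τ z ∧ N.edge z σ w := by
  induction τ generalizing v with
  | nil => simp [NFAA.ReachFrom]
  | cons ρ τ ih =>
    simp only [List.cons_append, NFAA.ReachFrom, ih]
    tauto

/-- **Forward Refinement Correctness (fixed-point form).** For a forward-stable
partition whose member containing the start vertex is the singleton of the
start vertex, each member is either contained in or disjoint from the set of
vertices reachable on any given sequence. -/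
theorem fwd_refinement_correctness (N : NFAA V A T) (L : Set (Set V))
    (hpart : IsPartitionOf L)
    (hstart : ∀ Z ∈ L, N.start ∈ Z → Z = {N.start})
    (hstable : N.FwdStable L) :
    ∀ τ : List (Option A), ∀ Z ∈ L,
      Z ⊆ {w : V | N.Reach τ w} ∨ Z ∩ {w : V | N.Reach τ w} = ∅ := by
  obtain ⟨-, -, hcover⟩ := hpart
  intro τ
  induction τ using List.reverseRecOn with
  | nil =>
    intro Z hZ
    by_cases hv : N.start ∈ Z
    · left
      rw [hstart Z hZ hv]
      rintro w rfl
      rfl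
    · right
      refine Set.eq_empty_of_forall_notMem ?_
      rintro w ⟨hw, rfl⟩
      exact hv hw
  | append_singleton τ σ ih =>
    intro Y hY
    refine or_iff_not_imp_right.mpr fun hne => ?_
    obtain ⟨y, hyY, hy⟩ := Set.nonempty_iff_ne_empty.mpr hne
    obtain ⟨z, hz, hzy⟩ := (N.reachFrom_append_singleton _ _ _ _).mp hy
    obtain ⟨Z, hZ, hzZ⟩ : z ∈ ⋃₀ L := hcover ▸ Set.mem_univ z
    have hZτ : Z ⊆ {w : V | N.Reach τ w} :=
      (ih Z hZ).resolve_right (Set.Nonempty.ne_empty ⟨z, hzZ, hz⟩)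
    have hYZ : Y ⊆ N.fwdImg Z σ :=
      (hstable Z hZ σ Y hY).resolve_right (Set.Nonempty.ne_empty ⟨y, hyY, z, hzZ, hzy⟩)
    intro w hw
    obtain ⟨z', hz', hzw⟩ := hYZ hw
    exact (N.reachFrom_append_singleton _ _ _ _).mpr ⟨z', hZτ hz', hzw⟩
end

section
/- Backward-Equivalent Reachability Preservation: Let N be an NFA with vertex type V, let L0 be a partition of V, and let ∼ be an equivalence relation on V that refines backward-equivalence with respect to L0 (i.e. v ∼ w implies v ∼bwd(L0) w). Then for every Z ∈ L0, every vertex c of the grouped NFA N/∼, and every sequence τ : List (Option A): if some vertex d of N/∼ with (every w with ⟦w⟧ = d satisfies w ∈ Z) is reachable from c on τ in N/∼, then for every v : V with ⟦v⟧ = c, some element of Z is reachable from v on τ in N. -/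
variable {V A T : Type*}

/-- **Backward-Equivalent Reachability Preservation.** If the equivalence
relation `s` refines backward-equivalence w.r.t. `L0`, then whenever a grouped
vertex all of whose members lie in `Z ∈ L0` is reachable from `c` on `τ` in
the grouped NFA, every representative of `c` reaches some element of `Z` on
`τ` in `N`. -/
theorem bwd_equiv_reachability_preservation (N : NFAA V A T)
    (L0 : Set (Set V)) (hpart : IsPartitionOf L0) (s : Setoid V)
    (hrefine : ∀ v w : V, s.r v w → N.BwdEquiv L0 v w) :
    ∀ Z ∈ L0, ∀ (c : Quotient s) (τ : List (Option A)),
      (∃ d : Quotient s, (∀ w : V, Quotient.mk s w = d → w ∈ Z) ∧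
          (N.group s).ReachFrom c τ d) →
        ∀ v : V, Quotient.mk s v = c → ∃ w ∈ Z, N.ReachFrom v τ w := by
  rintro Z hZ c τ ⟨d, hd, hreach⟩
  induction τ generalizing c with
  | nil =>
    intro v hv
    exact ⟨v, hd v (hv.trans hreach), rfl⟩
  | cons σ τ ih =>
    intro v hv
    obtain ⟨e, ⟨x, y, hx, hy, hxy⟩, he⟩ := hreach
    obtain ⟨w, hw, hyw⟩ := ih e he y hy
    exact (hrefine v x (Quotient.exact (hv.trans hx.symm)) Z hZ (σ :: τ)).mpr
      ⟨w, hw, y, hxy, hyw⟩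
end

section
/- Backward Refinement Correctness (fixed-point form): Let N be an NFA with vertex type V, let L0 be a partition of V, and let L be a partition of V that refines L0 and is backward-stable. Then for every Z ∈ L0 and every sequence τ : List (Option A), letting R_Z(τ) := {v | some element of Z is reachable from v on τ}, every Y ∈ L satisfies Y ⊆ R_Z(τ) or Y ∩ R_Z(τ) = ∅. -/
variable {V A T : Type*}

/-- In a backward-stable partition, vertices in a common block reach the blocks of a coarser
partition on the same sequences. -/
theorem NFAA.BwdStable.exists_reachFrom {N : NFAA V A T} {L0 L : Set (Set V)}
    (hstable : N.BwdStable L) (hdisj : ∀ Z ∈ L0, ∀ Z' ∈ L0, Z ≠ Z' → Z ∩ Z' = ∅)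
    (hcover : ⋃₀ L = Set.univ) (hrefines : RefinesPartition L L0) {Z : Set V} (hZ : Z ∈ L0)
    (τ : List (Option A)) {Y : Set V} (hY : Y ∈ L) {x y : V} (hx : x ∈ Y) (hy : y ∈ Y)
    (h : ∃ w ∈ Z, N.ReachFrom x τ w) : ∃ w ∈ Z, N.ReachFrom y τ w := by
  induction τ generalizing Y x y with
  | nil =>
    obtain ⟨w, hw, rfl⟩ := h
    obtain ⟨Z', hZ', hYZ'⟩ := hrefines Y hY
    have hZZ' : Z = Z' := by
      by_contra hne
      exact Set.eq_empty_iff_forall_notMem.mp (hdisj Z hZ Z' hZ' hne) x ⟨hw, hYZ' hx⟩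
    exact ⟨y, hZZ' ▸ hYZ' hy, rfl⟩
  | cons σ τ ih =>
    obtain ⟨w, hw, u, hxu, huw⟩ := h
    obtain ⟨X, hX, huX⟩ : u ∈ ⋃₀ L := hcover ▸ Set.mem_univ u
    rcases hstable X hX σ Y hY with hsub | hempty
    · obtain ⟨u', hu'X, hyu'⟩ := hsub hy
      obtain ⟨w', hw', hu'w'⟩ := ih hX huX hu'X ⟨w, hw, huw⟩
      exact ⟨w', hw', u', hyu', hu'w'⟩
    · exact absurd ⟨hx, u, huX, hxu⟩ (Set.eq_empty_iff_forall_notMem.mp hempty x)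

/-- **Backward Refinement Correctness (fixed-point form).** For a
backward-stable partition `L` refining `L0`, each member of `L` is either
contained in or disjoint from the set of vertices from which some element of
a given `Z ∈ L0` is reachable on any given sequence. -/
theorem bwd_refinement_correctness (N : NFAA V A T) (L0 L : Set (Set V))
    (hpart0 : IsPartitionOf L0) (hpart : IsPartitionOf L)
    (hrefines : RefinesPartition L L0) (hstable : N.BwdStable L) :
    ∀ Z ∈ L0, ∀ τ : List (Option A), ∀ Y ∈ L,
      Y ⊆ {v : V | ∃ w ∈ Z, N.ReachFrom v τ w} ∨
        Y ∩ {v : V | ∃ w ∈ Z, N.ReachFrom v τ w} = ∅ := by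
  intro Z hZ τ Y hY
  refine or_iff_not_imp_right.mpr fun hne y hy => ?_
  obtain ⟨x, hx, hreach⟩ := Set.nonempty_iff_ne_empty.mpr hne
  exact hstable.exists_reachFrom hpart0.2.1 hpart.2.2 hrefines hZ τ hY hx hy hreach
end

section
/- Backward Refinement Algorithm invariant: Let N be an NFA with vertex type V, let L₀ be a partition of V, and define partitions iteratively by letting L_{i+1} be the common refinement of L_i by the family of sets Z⁻[σ] for all Z ∈ L_i and σ : Option A (i.e. v and w lie in the same member of L_{i+1} iff they lie in the same member of L_i and, for each Z ∈ L_i and σ, v ∈ Z⁻[σ] iff w ∈ Z⁻[σ]). Then for every i, every Z ∈ L₀, and every sequence τ : List (Option A) of length i, letting R_Z(τ) := {v | some element of Z is reachable from v on τ}, every Y ∈ L_i satisfies Y ⊆ R_Z(τ) or Y ∩ R_Z(τ) = ∅. -/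
variable {V A T : Type*}

/-- One step of the backward refinement algorithm: the common refinement of
`L` by the sets `Z⁻[σ]` for `Z ∈ L` and labels `σ`; vertices `v, w` lie in
the same member iff they lie in the same member of `L` and agree on
membership in each `Z⁻[σ]`. -/
def bwdRefineStep (N : NFAA V A T) (L : Set (Set V)) : Set (Set V) :=
  {Y : Set V | Y.Nonempty ∧ ∃ v : V,
    Y = {w : V | (∃ Z ∈ L, v ∈ Z ∧ w ∈ Z) ∧
          ∀ Z ∈ L, ∀ σ : Option A, (v ∈ N.bwdImg Z σ ↔ w ∈ N.bwdImg Z σ)}}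

/-- The iterated partitions of the backward refinement algorithm. -/
def bwdRefineSeq (N : NFAA V A T) (L0 : Set (Set V)) : ℕ → Set (Set V)
  | 0 => L0
  | i + 1 => bwdRefineStep N (bwdRefineSeq N L0 i)

/-- A refinement step preserves the property of covering all vertices. -/
theorem sUnion_bwdRefineStep (N : NFAA V A T) {L : Set (Set V)} (hL : ⋃₀ L = Set.univ) :
    ⋃₀ bwdRefineStep N L = Set.univ := by
  refine Set.eq_univ_of_forall fun v => ?_
  obtain ⟨Z, hZ, hv⟩ : v ∈ ⋃₀ L := hL ▸ Set.mem_univ v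
  refine ⟨_, ⟨⟨v, ?_⟩, v, rfl⟩, ?_⟩ <;> exact ⟨⟨Z, hZ, hv, hv⟩, fun _ _ _ => Iff.rfl⟩

/-- Every iterate of the refinement covers all vertices if the initial family does. -/
theorem sUnion_bwdRefineSeq (N : NFAA V A T) {L0 : Set (Set V)} (hL : ⋃₀ L0 = Set.univ) :
    ∀ i : ℕ, ⋃₀ bwdRefineSeq N L0 i = Set.univ
  | 0 => hL
  | i + 1 => sUnion_bwdRefineStep N (sUnion_bwdRefineSeq N hL i)

/-- Vertices in the same member of a refinement step agree on membership in backward images. -/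
theorem mem_bwdImg_of_mem_bwdRefineStep (N : NFAA V A T) {L : Set (Set V)} {Y Z : Set V}
    (hY : Y ∈ bwdRefineStep N L) (hZ : Z ∈ L) {σ : Option A} {x y : V}
    (hx : x ∈ Y) (hy : y ∈ Y) (hxZ : x ∈ N.bwdImg Z σ) : y ∈ N.bwdImg Z σ := by
  obtain ⟨-, v, rfl⟩ := hY
  exact (hy.2 Z hZ σ).1 ((hx.2 Z hZ σ).2 hxZ)

/-- Vertices in the same member of the `i`-th partition reach the same members of the initial
partition on every sequence of length `i`. -/
theorem exists_reachFrom_of_mem_bwdRefineSeq (N : NFAA V A T) {L0 : Set (Set V)}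
    (hpart : IsPartitionOf L0) {Z : Set V} (hZ : Z ∈ L0) (τ : List (Option A)) :
    ∀ Y ∈ bwdRefineSeq N L0 τ.length, ∀ x ∈ Y, ∀ y ∈ Y,
      (∃ w ∈ Z, N.ReachFrom x τ w) → ∃ w ∈ Z, N.ReachFrom y τ w := by
  induction τ with
  | nil =>
    rintro Y hY x hx y hy ⟨w, hw, rfl⟩
    have hYZ : Y = Z := by
      by_contra hne
      exact Set.eq_empty_iff_forall_notMem.1 (hpart.2.1 Y hY Z hZ hne) x ⟨hx, hw⟩
    exact ⟨y, hYZ ▸ hy, rfl⟩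
  | cons σ τ ih =>
    rintro Y hY x hx y hy ⟨w, hw, u, hxu, huw⟩
    obtain ⟨X, hX, hu⟩ : u ∈ ⋃₀ bwdRefineSeq N L0 τ.length :=
      sUnion_bwdRefineSeq N hpart.2.2 τ.length ▸ Set.mem_univ u
    obtain ⟨u', hu', hyu'⟩ := mem_bwdImg_of_mem_bwdRefineStep N hY hX hx hy ⟨u, hu, hxu⟩
    obtain ⟨w', hw', hr⟩ := ih X hX u hu u' hu' ⟨w, hw, huw⟩
    exact ⟨w', hw', u', hyu', hr⟩

/-- **Backward Refinement Algorithm invariant.** At step `i`, every member of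
`L_i` is either contained in or disjoint from the set of vertices from which
some element of a given `Z ∈ L₀` is reachable on any sequence of length `i`. -/
theorem bwd_refinement_algorithm_invariant (N : NFAA V A T)
    (L0 : Set (Set V)) (hpart : IsPartitionOf L0) :
    ∀ (i : ℕ), ∀ Z ∈ L0, ∀ τ : List (Option A), τ.length = i →
      ∀ Y ∈ bwdRefineSeq N L0 i,
        Y ⊆ {v : V | ∃ w ∈ Z, N.ReachFrom v τ w} ∨
          Y ∩ {v : V | ∃ w ∈ Z, N.ReachFrom v τ w} = ∅ := by
  rintro _ Z hZ τ rfl Y hY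
  refine or_iff_not_imp_right.2 fun hne y hy => ?_
  obtain ⟨x, hx, hxr⟩ := Set.nonempty_iff_ne_empty.2 hne
  exact exists_reachFrom_of_mem_bwdRefineSeq N hpart hZ τ Y hY x hx y hy hxr
end
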